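/- For 0 < α < 1 and x > 0: ∫₀^∞ log|x − u| · (sin(πα)/π) · u^{α−1}/(u^{2α} + 2u^α cos(πα) + 1) du = (1/(2α)) · log( x^{2α} + 2x^α cos(απ) + 1 ). -/

import Mathlib

open Real MeasureTheory Set Filter Topology

noncomputable def MM (α : ℝ) (z : ℂ) : ℂ := Complex.exp (α * z) / (1 + Complex.exp (α * z))
noncomputable def DD (α v : ℝ) : ℝ := exp (v * α) ^ 2 + 2 * exp (v * α) * cos (π * α) + 1
noncomputable def PP (α v : ℝ) : ℝ := (1 / (2 * α)) * log (DD α v)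
noncomputable def gg (α v : ℝ) : ℝ := sin (π * α) * exp (v * α) / DD α v
noncomputable def qq (α v : ℝ) : ℝ := (exp (v * α) ^ 2 + exp (v * α) * cos (π * α)) / DD α v

lemma sin_pos' {α : ℝ} (h0 : 0 < α) (h1 : α < 1) : 0 < sin (π * α) :=
  sin_pos_of_pos_of_lt_pi (by positivity) (by nlinarith [pi_pos])

lemma DD_pos {α : ℝ} (h0 : 0 < α) (h1 : α < 1) (v : ℝ) : 0 < DD α v := by
  have := sin_pos' h0 h1
  have e : DD α v = (exp (v * α) + cos (π * α)) ^ 2 + sin (π * α) ^ 2 := by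
    unfold DD; nlinarith [sin_sq_add_cos_sq (π * α)]
  rw [e]; positivity

lemma one_add_exp_ne {α : ℝ} (h0 : 0 < α) (h1 : α < 1) {z : ℂ} (hz0 : 0 ≤ z.im) (hz1 : z.im ≤ π) :
    1 + Complex.exp (α * z) ≠ 0 := by
  intro h
  have him := congrArg Complex.im h
  have hre := congrArg Complex.re h
  simp [Complex.exp_re, Complex.exp_im] at him hre
  rcases hz0.eq_or_lt with h' | h'
  · rw [← h'] at hre
    simp at hre
    linarith [exp_pos (α * z.re)]
  · have := sin_pos_of_pos_of_lt_pi (x := α * z.im) (by positivity) (by nlinarith [pi_pos])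
    linarith

lemma cexp_pi (α v : ℝ) : Complex.exp (α * (v + π * Complex.I)) =
    ⟨exp (v * α) * cos (π * α), exp (v * α) * sin (π * α)⟩ := by
  apply Complex.ext <;> rw [mul_comm] <;> simp [Complex.exp_re, Complex.exp_im]

lemma MM_pi {α : ℝ} (h0 : 0 < α) (h1 : α < 1) (v : ℝ) :
    MM α (v + π * Complex.I) = ⟨qq α v, gg α v⟩ := by
  have hD := (DD_pos h0 h1 v).ne'
  have hn := one_add_exp_ne h0 h1 (z := v + π * Complex.I) (by simp [pi_pos.le]) (by simp)
  unfold MM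
  rw [div_eq_iff hn, cexp_pi]
  have hsc := sin_sq_add_cos_sq (π * α)
  have e1 : qq α v * (1 + exp (v*α) * cos (π * α)) - gg α v * (exp (v*α) * sin (π * α)) =
      exp (v * α) * cos (π * α) := by
    unfold qq gg
    unfold DD at *
    generalize cos (π * α) = c at *
    generalize sin (π * α) = s at *
    generalize exp (v * α) = t at *
    rw [div_mul_eq_mul_div, div_mul_eq_mul_div, ← sub_div, div_eq_iff hD]
    linear_combination (-t ^ 2) * hsc
  have e2 : qq α v * (exp (v*α) * sin (π * α)) + gg α v * (1 + exp (v*α) * cos (π * α)) =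
      exp (v * α) * sin (π * α) := by
    unfold qq gg
    unfold DD at *
    generalize cos (π * α) = c at *
    generalize sin (π * α) = s at *
    generalize exp (v * α) = t at *
    rw [div_mul_eq_mul_div, div_mul_eq_mul_div, ← add_div, div_eq_iff hD]
    ring
  apply Complex.ext
  · simp; linarith
  · simp; linarith

lemma cont_exp_DD (α : ℝ) : Continuous (DD α) := by unfold DD; fun_prop

lemma cont_gg {α : ℝ} (h0 : 0 < α) (h1 : α < 1) : Continuous (gg α) := by
  unfold gg
  exact Continuous.div (by fun_prop) (cont_exp_DD α) (fun v => (DD_pos h0 h1 v).ne')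

lemma cont_qq {α : ℝ} (h0 : 0 < α) (h1 : α < 1) : Continuous (qq α) := by
  unfold qq
  exact Continuous.div (by fun_prop) (cont_exp_DD α) (fun v => (DD_pos h0 h1 v).ne')

lemma PP_deriv {α : ℝ} (h0 : 0 < α) (h1 : α < 1) (v : ℝ) : HasDerivAt (PP α) (qq α v) v := by
  have hD := (DD_pos h0 h1 v).ne'
  have he : HasDerivAt (fun v : ℝ => exp (v * α)) (exp (v * α) * α) v := by
    simpa using ((hasDerivAt_id v).mul_const α).exp
  have h := ((((he.pow 2).add ((he.const_mul 2).mul_const (cos (π * α)))).add_const 1).log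
    (by exact hD)).const_mul (1 / (2 * α))
  refine HasDerivAt.congr_deriv h ?_
  unfold qq
  rw [← mul_div_assoc]
  congr 1
  simp
  field_simp

lemma int_qq {α : ℝ} (h0 : 0 < α) (h1 : α < 1) (a b : ℝ) :
    ∫ v in a..b, qq α v = PP α b - PP α a :=
  intervalIntegral.integral_eq_sub_of_hasDerivAt (fun v _ => PP_deriv h0 h1 v)
    ((cont_qq h0 h1).intervalIntegrable _ _)

lemma norm_clog_le (w : ℂ) : ‖Complex.log w‖ ≤ |log ‖w‖| + π := by
  refine (Complex.norm_le_abs_re_add_abs_im _).trans ?_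
  rw [Complex.log_re, Complex.log_im]
  gcongr
  exact Complex.abs_arg_le_pi w

lemma MM_cont {α : ℝ} (h0 : 0 < α) (h1 : α < 1) {γ : ℝ → ℂ} {S : Set ℝ} (hγ : Continuous γ)
    (him : ∀ t ∈ S, 0 ≤ (γ t).im ∧ (γ t).im ≤ π) : ContinuousOn (fun t => MM α (γ t)) S := by
  unfold MM
  exact ContinuousOn.div (by fun_prop) (by fun_prop)
    (fun t ht => one_add_exp_ne h0 h1 (him t ht).1 (him t ht).2)

/-- Convergence of one side integral as the regularisation parameter goes to zero. -/
lemma side {α x : ℝ} (h0 : 0 < α) (h1 : α < 1) (γ : ℝ → ℂ)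
    (hγ : ∀ t, AnalyticAt ℝ γ t) (a b c : ℝ)
    (him : ∀ t ∈ uIcc a b, 0 ≤ (γ t).im ∧ (γ t).im ≤ π)
    (hne : ∀ t, t ≠ c → t ∈ uIcc a b → x + Complex.exp (γ t) ≠ 0) :
    Tendsto (fun ε : ℝ => ∫ t in a..b, Complex.log (x + ε * Complex.I + Complex.exp (γ t)) * MM α (γ t))
      (𝓝[>] 0) (𝓝 (∫ t in a..b, Complex.log (x + Complex.exp (γ t)) * MM α (γ t))) := by
  have hγc : Continuous γ := continuous_iff_continuousAt.2 fun t => (hγ t).continuousAt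
  have hexpim : ∀ t ∈ uIcc a b, 0 ≤ (x + Complex.exp (γ t)).im := by
    intro t ht
    have := sin_nonneg_of_nonneg_of_le_pi (him t ht).1 (him t ht).2
    simp [Complex.exp_im]
    positivity
  have hMc := MM_cont h0 h1 hγc him
  obtain ⟨K, hK⟩ := isCompact_uIcc.exists_bound_of_continuousOn hMc
  have hlogint : IntervalIntegrable (fun t => log ‖(x + Complex.exp (γ t) : ℂ)‖) volume a b := by
    apply MeromorphicOn.intervalIntegrable_log_norm
    intro t _
    apply AnalyticAt.meromorphicAt
    exact analyticAt_const.add (AnalyticAt.comp (g := Complex.exp) (analyticAt_cexp.restrictScalars (𝕜 := ℝ)) (hγ t))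
  refine intervalIntegral.tendsto_integral_filter_of_dominated_convergence
    (fun t => (|log ‖(x + Complex.exp (γ t) : ℂ)‖| + log (‖(x + Complex.exp (γ t) : ℂ)‖ + 1) + π) * K) ?_ ?_ ?_ ?_
  · refine Eventually.of_forall fun ε => Measurable.aestronglyMeasurable ?_
    have : Measurable γ := hγc.measurable
    unfold MM
    fun_prop
  · have : ∀ᶠ ε : ℝ in 𝓝[>] 0, ε ∈ Ioo (0:ℝ) 1 := Ioo_mem_nhdsGT one_pos
    filter_upwards [this] with ε hε
    have hc : ∀ᵐ t : ℝ, t ≠ c := by simp [ae_iff]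
    filter_upwards [hc] with t htc ht
    have ht := uIoc_subset_uIcc ht
    have hw := hne t htc ht
    have hwi := hexpim t ht
    rw [norm_mul]
    have e : (x + ε * Complex.I + Complex.exp (γ t) : ℂ) = (x + Complex.exp (γ t)) + ε * Complex.I := by ring
    rw [e]
    generalize (x + Complex.exp (γ t) : ℂ) = w at *
    have hwp : 0 < ‖w‖ := norm_pos_iff.2 hw
    have l1 : ‖w‖ ≤ ‖w + ε * Complex.I‖ := by
      rw [Complex.norm_def, Complex.norm_def]
      apply Real.sqrt_le_sqrt
      simp [Complex.normSq_apply]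
      nlinarith [hε.1]
    have l2 : ‖w + ε * Complex.I‖ ≤ ‖w‖ + 1 := by
      refine (norm_add_le _ _).trans ?_
      simp [abs_of_pos hε.1, hε.2.le]
    have l3 := log_le_log hwp l1
    have l4 := log_le_log (hwp.trans_le l1) l2
    have l5 : 0 ≤ log (‖w‖ + 1) := log_nonneg (by linarith)
    have l6 : |log ‖w + ε * Complex.I‖| ≤ |log ‖w‖| + log (‖w‖ + 1) := by
      rw [abs_le]
      constructor
      · linarith [neg_abs_le (log ‖w‖)]
      · linarith [abs_nonneg (log ‖w‖)]
    have := pi_pos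
    have l7 := norm_clog_le (w + ε * Complex.I)
    apply mul_le_mul (by linarith) (hK t ht) (norm_nonneg _) (by positivity)
  · refine IntervalIntegrable.mul_const (((hlogint.abs).add ?_).add intervalIntegrable_const) K
    apply Continuous.intervalIntegrable
    refine Continuous.log (by fun_prop) (fun t => by positivity)
  · have hc : ∀ᵐ t : ℝ, t ≠ c := by simp [ae_iff]
    filter_upwards [hc] with t htc ht
    have ht := uIoc_subset_uIcc ht
    have hw := hne t htc ht
    have hwi := hexpim t ht
    refine Tendsto.mul_const _ ?_
    have e : ∀ ε : ℝ, (x + ε * Complex.I + Complex.exp (γ t) : ℂ) = (x + Complex.exp (γ t)) + ε * Complex.I := by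
      intro; ring
    simp only [e]
    generalize (x + Complex.exp (γ t) : ℂ) = w at *
    have hcw : ContinuousWithinAt Complex.log {z : ℂ | 0 ≤ z.im} w := by
      by_cases hs : w ∈ Complex.slitPlane
      · exact (continuousAt_clog hs).continuousWithinAt
      · rw [Complex.mem_slitPlane_iff] at hs
        push Not at hs
        refine Complex.continuousWithinAt_log_of_re_neg_of_im_zero ?_ hs.2
        refine lt_of_le_of_ne hs.1 fun h => hw (Complex.ext h hs.2)
    refine hcw.tendsto.comp (tendsto_nhdsWithin_iff.2 ⟨?_, ?_⟩)
    · have : Continuous fun ε : ℝ => w + ε * Complex.I := by fun_prop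
      have := this.tendsto 0
      simp only [Complex.ofReal_zero, zero_mul, add_zero] at this
      exact this.mono_left nhdsWithin_le_nhds
    · filter_upwards [self_mem_nhdsWithin] with ε hε
      simp at hε ⊢
      linarith

noncomputable def ff (α x : ℝ) (z : ℂ) : ℂ := Complex.log (x + Complex.exp z) * MM α z

lemma rect {α x : ℝ} (h0 : 0 < α) (h1 : α < 1) (hx : 0 < x) {R : ℝ} (hR : |log x| < R) :
    (∫ v in (-R)..R, ff α x v) - (∫ v in (-R)..R, ff α x (v + π * Complex.I)) +
      Complex.I * (∫ y in (0:ℝ)..π, ff α x (R + y * Complex.I)) -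
      Complex.I * (∫ y in (0:ℝ)..π, ff α x (-R + y * Complex.I)) = 0 := by
  have hpi := pi_pos
  have key : ∀ v : ℝ, x + Complex.exp (v + π * Complex.I) = ((x - exp v : ℝ) : ℂ) := by
    intro v
    rw [Complex.exp_add, Complex.exp_pi_mul_I]; push_cast; ring
  have hnv : ∀ v y : ℝ, v ≠ log x → (x + Complex.exp (v + y * Complex.I) : ℂ) ≠ 0 := by
    intro v y hv h
    have : Complex.exp (v + y * Complex.I) = -x := by linear_combination h
    have := congrArg norm this
    rw [Complex.norm_exp] at this
    simp [abs_of_pos hx] at this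
    exact hv (by rw [← this, log_exp])
  have hRp : 0 < R := (abs_nonneg _).trans_lt hR
  have hR1 : R ≠ log x := fun h => by rw [← h] at hR; exact absurd hR (not_lt.2 (le_abs_self _))
  have hR2 : -R ≠ log x := fun h => by rw [← h, abs_neg] at hR; exact absurd hR (not_lt.2 (le_abs_self _))
  have anR : ∀ t, AnalyticAt ℝ (fun v : ℝ => (v : ℂ)) t := fun t => Complex.ofRealCLM.analyticAt t
  have s1 := side h0 h1 (fun v : ℝ => (v : ℂ)) anR (-R) R (log x)
    (by intro t _; simp [hpi.le]) (by intro t ht _; simpa using hnv t 0 ht)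
  have s2 := side h0 h1 (fun v : ℝ => (v + π * Complex.I : ℂ))
    (fun t => (anR t).add analyticAt_const) (-R) R (log x)
    (by intro t _; simp [hpi.le]) (by intro t ht _; exact hnv t π ht)
  have s3 := side h0 h1 (fun y : ℝ => (R + y * Complex.I : ℂ))
    (fun t => analyticAt_const.add ((anR t).mul analyticAt_const)) 0 π (-1)
    (by intro t ht; rw [uIcc_of_le hpi.le] at ht; simpa using ht) (by intro t ht _; exact hnv R t hR1)
  have s4 := side h0 h1 (fun y : ℝ => (-R + y * Complex.I : ℂ))
    (fun t => analyticAt_const.add ((anR t).mul analyticAt_const)) 0 π (-1)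
    (by intro t ht; rw [uIcc_of_le hpi.le] at ht; simpa using ht)
    (by intro t ht _; simpa using hnv (-R) t hR2)
  have lim := ((s1.sub s2).add (s3.const_mul Complex.I)).sub (s4.const_mul Complex.I)
  refine tendsto_nhds_unique lim ?_
  refine tendsto_const_nhds.congr' ?_
  filter_upwards [self_mem_nhdsWithin] with ε hε
  have hε : 0 < ε := hε
  have := Complex.integral_boundary_rect_eq_zero_of_differentiableOn
    (fun z => Complex.log (x + ε * Complex.I + Complex.exp z) * MM α z) (-R : ℝ) ((R : ℝ) + (π : ℝ) * Complex.I) ?_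
  · simpa using this.symm
  · intro z hz
    obtain ⟨-, hz⟩ := hz
    simp [uIcc_of_le hpi.le] at hz
    refine DifferentiableAt.differentiableWithinAt ?_
    have := one_add_exp_ne h0 h1 hz.1 hz.2
    unfold MM
    refine DifferentiableAt.mul (DifferentiableAt.clog (by fun_prop) ?_) 
      (DifferentiableAt.div (by fun_prop) (by fun_prop) this)
    right
    have := sin_nonneg_of_nonneg_of_le_pi hz.1 hz.2
    simp [Complex.exp_im]
    positivity

lemma sideInt {α x : ℝ} (h0 : 0 < α) (h1 : α < 1) (γ : ℝ → ℂ)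
    (hγ : ∀ t, AnalyticAt ℝ γ t) (a b : ℝ)
    (him : ∀ t ∈ uIcc a b, 0 ≤ (γ t).im ∧ (γ t).im ≤ π) :
    IntervalIntegrable (fun t => ff α x (γ t)) volume a b := by
  have hγc : Continuous γ := continuous_iff_continuousAt.2 fun t => (hγ t).continuousAt
  have hMc := MM_cont h0 h1 hγc him
  obtain ⟨K, hK⟩ := isCompact_uIcc.exists_bound_of_continuousOn hMc
  have hlogint : IntervalIntegrable (fun t => log ‖(x + Complex.exp (γ t) : ℂ)‖) volume a b := by
    apply MeromorphicOn.intervalIntegrable_log_norm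
    intro t _
    apply AnalyticAt.meromorphicAt
    exact analyticAt_const.add (AnalyticAt.comp (g := Complex.exp) (analyticAt_cexp.restrictScalars (𝕜 := ℝ)) (hγ t))
  have hb : IntervalIntegrable (fun t => (|log ‖(x + Complex.exp (γ t) : ℂ)‖| + π) * K) volume a b :=
    (hlogint.abs.add intervalIntegrable_const).mul_const K
  refine hb.mono_fun' ?_ ?_
  · refine Measurable.aestronglyMeasurable ?_
    have : Measurable γ := hγc.measurable
    unfold ff MM
    fun_prop
  · refine (ae_restrict_iff' measurableSet_uIoc).2 (Eventually.of_forall fun t ht => ?_)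
    have ht := uIoc_subset_uIcc ht
    have := pi_pos
    change ‖Complex.log (x + Complex.exp (γ t)) * MM α (γ t)‖ ≤ (|log ‖(x + Complex.exp (γ t) : ℂ)‖| + π) * K
    rw [norm_mul]
    exact mul_le_mul (norm_clog_le _) (hK t ht) (norm_nonneg _) (by positivity)

lemma ff_im {α x : ℝ} (h0 : 0 < α) (h1 : α < 1) (hx : 0 < x) (v : ℝ) :
    (ff α x (v + π * Complex.I)).im =
      log |x - exp v| * gg α v + (Ioi (log x)).indicator (fun v => π * qq α v) v := by
  have key : x + Complex.exp (v + π * Complex.I) = ((x - exp v : ℝ) : ℂ) := by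
    rw [Complex.exp_add, Complex.exp_pi_mul_I]; push_cast; ring
  unfold ff
  rw [key, MM_pi h0 h1, Complex.mul_im, Complex.log_re, Complex.log_im, Complex.norm_real, norm_eq_abs]
  congr 1
  by_cases hv : log x < v
  · have : x < exp v := (log_lt_iff_lt_exp hx).1 hv
    rw [indicator_of_mem (by exact hv), Complex.arg_ofReal_of_neg (by linarith)]
  · have : exp v ≤ x := (le_log_iff_exp_le hx).1 (not_lt.1 hv)
    rw [indicator_of_notMem (by exact hv), Complex.arg_ofReal_of_nonneg (by linarith), zero_mul]

lemma logg_int {x : ℝ} (a b : ℝ) : IntervalIntegrable (fun v => log |x - exp v|) volume a b := by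
  apply MeromorphicOn.intervalIntegrable_log_norm (f := fun v => x - exp v)
  intro t _
  exact AnalyticAt.meromorphicAt (by fun_prop)

lemma finiteR {α x : ℝ} (h0 : 0 < α) (h1 : α < 1) (hx : 0 < x) {R : ℝ} (hR : |log x| < R) :
    (∫ v in (-R)..R, log |x - exp v| * gg α v) = π * PP α (log x) +
      ((∫ y in (0:ℝ)..π, (ff α x (R + y * Complex.I)).re) - π * R) - π * (PP α R - R)
        - ∫ y in (0:ℝ)..π, (ff α x (-R + y * Complex.I)).re := by
  have hpi := pi_pos
  have hRp : 0 < R := (abs_nonneg _).trans_lt hR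
  have hr := congrArg Complex.im (rect h0 h1 hx hR)
  have anR : ∀ t, AnalyticAt ℝ (fun v : ℝ => (v : ℂ)) t := fun t => Complex.ofRealCLM.analyticAt t
  have i2 := sideInt (x := x) h0 h1 (fun v : ℝ => (v + π * Complex.I : ℂ))
    (fun t => (anR t).add analyticAt_const) (-R) R (by intro t _; simp [hpi.le])
  have i3 := sideInt (x := x) h0 h1 (fun y : ℝ => (R + y * Complex.I : ℂ))
    (fun t => analyticAt_const.add ((anR t).mul analyticAt_const)) 0 π
    (by intro t ht; rw [uIcc_of_le hpi.le] at ht; simpa using ht)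
  have i4 := sideInt (x := x) h0 h1 (fun y : ℝ => (-R + y * Complex.I : ℂ))
    (fun t => analyticAt_const.add ((anR t).mul analyticAt_const)) 0 π
    (by intro t ht; rw [uIcc_of_le hpi.le] at ht; simpa using ht)
  have e1 : (∫ v in (-R)..R, ff α x v).im = 0 := by
    have : ∀ v : ℝ, ff α x v = ((log (x + exp v) * (exp (α * v) / (1 + exp (α * v))) : ℝ) : ℂ) := by
      intro v
      unfold ff MM
      push_cast
      rw [Complex.ofReal_log (by positivity)]
      push_cast
      rfl
    simp_rw [this]
    rw [intervalIntegral.integral_ofReal, Complex.ofReal_im]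
  have e2 : (∫ v in (-R)..R, ff α x (v + π * Complex.I)).im =
      (∫ v in (-R)..R, log |x - exp v| * gg α v) + π * (PP α R - PP α (log x)) := by
    have := Complex.imCLM.intervalIntegral_comp_comm i2
    simp only [Complex.imCLM_apply] at this
    rw [← this]
    simp_rw [ff_im h0 h1 hx]
    rw [intervalIntegral.integral_add]
    · congr 1
      rw [intervalIntegral.integral_of_le (by linarith), setIntegral_indicator measurableSet_Ioi]
      have : Ioc (-R) R ∩ Ioi (log x) = Ioc (log x) R := by
        rw [Ioc_inter_Ioi, max_eq_right]
        linarith [neg_abs_le (log x)]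
      rw [this, ← intervalIntegral.integral_of_le (by linarith [le_abs_self (log x)]),
        intervalIntegral.integral_const_mul, int_qq h0 h1]
    · exact (logg_int _ _).mul_continuousOn (cont_gg h0 h1).continuousOn
    · have : IntervalIntegrable (fun v => π * qq α v) volume (-R) R :=
        (continuous_const.mul (cont_qq h0 h1)).intervalIntegrable _ _
      rw [intervalIntegrable_iff] at this ⊢
      exact this.indicator measurableSet_Ioi
  have e3 := Complex.reCLM.intervalIntegral_comp_comm i3
  have e4 := Complex.reCLM.intervalIntegral_comp_comm i4
  simp only [Complex.reCLM_apply] at e3 e4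
  simp only [Complex.sub_im, Complex.add_im, Complex.I_mul_im, Complex.zero_im] at hr
  rw [e1, e2, ← e3, ← e4] at hr
  linarith

lemma MM_norm {α : ℝ} (h0 : 0 < α) {R : ℝ} (hR : 0 < R) (y : ℝ) :
    ‖MM α (-R + y * Complex.I)‖ ≤ exp (-α * R) / (1 - exp (-α * R)) := by
  have hlt : exp (-α * R) < 1 := by rw [exp_lt_one_iff]; nlinarith
  have hn : ‖Complex.exp (α * (-R + y * Complex.I))‖ = exp (-α * R) := by
    rw [Complex.norm_exp]; simp
  unfold MM
  rw [norm_div, hn]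
  apply div_le_div_of_nonneg_left (exp_pos _).le (by linarith)
  have := norm_sub_norm_le (1:ℂ) (-Complex.exp (α * (-R + y * Complex.I)))
  rw [norm_neg, hn, norm_one, sub_neg_eq_add] at this
  exact this

lemma MM_norm' {α : ℝ} (h0 : 0 < α) {R : ℝ} (hR : 0 < R) (y : ℝ) :
    ‖MM α (R + y * Complex.I) - 1‖ ≤ exp (-α * R) / (1 - exp (-α * R)) := by
  have hlt : 1 < exp (α * R) := by rw [one_lt_exp_iff]; positivity
  have hn : ‖Complex.exp (α * (R + y * Complex.I))‖ = exp (α * R) := by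
    rw [Complex.norm_exp]; simp
  have := norm_sub_norm_le (Complex.exp (α * (R + y * Complex.I))) (-1)
  rw [norm_neg, hn, norm_one, sub_neg_eq_add, add_comm _ (1:ℂ)] at this
  have hne : 1 + Complex.exp (α * (R + y * Complex.I)) ≠ 0 := by
    rw [← norm_pos_iff]; linarith
  have e : MM α (R + y * Complex.I) - 1 = -1 / (1 + Complex.exp (α * (R + y * Complex.I))) := by
    unfold MM
    field_simp
    ring
  have e' : exp (-α * R) / (1 - exp (-α * R)) = 1 / (exp (α * R) - 1) := by
    rw [neg_mul, exp_neg]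
    have : exp (α * R) - 1 ≠ 0 := by linarith
    field_simp
  rw [e, e', norm_div, norm_neg, norm_one]
  exact div_le_div_of_nonneg_left one_pos.le (by linarith) this

/-- Comparison of logarithms: if `‖w‖` is within `a * r` of `a`, logs differ by at most `-log (1-r)`. -/
lemma log_cmp {a r m : ℝ} (ha : 0 < a) (hr0 : 0 ≤ r) (hr : r < 1) (h1 : a * (1 - r) ≤ m)
    (h2 : m ≤ a * (1 + r)) : |log m - log a| ≤ -log (1 - r) := by
  have hm : 0 < m := lt_of_lt_of_le (mul_pos ha (by linarith)) h1
  have l1 := log_le_log (mul_pos ha (by linarith)) h1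
  have l2 := log_le_log hm h2
  rw [log_mul ha.ne' (by linarith)] at l1 l2
  have l3 : log (1 + r) + log (1 - r) ≤ 0 := by
    rw [← log_mul (by linarith) (by linarith)]
    apply log_nonpos <;> nlinarith
  rw [abs_le]; constructor <;> linarith

lemma right_bound {α x : ℝ} (h0 : 0 < α) (hx : 0 < x) {R : ℝ} (hR : 0 < R)
    (hR' : x * exp (-R) < 1) (y : ℝ) :
    |(ff α x (R + y * Complex.I)).re - R| ≤
      -log (1 - x * exp (-R)) * (1 + exp (-α * R) / (1 - exp (-α * R))) +
        (R + π) * (exp (-α * R) / (1 - exp (-α * R))) := by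
  have hM := MM_norm' h0 hR y
  have hn : ‖Complex.exp (R + y * Complex.I)‖ = exp R := by rw [Complex.norm_exp]; simp
  have hxn : ‖(x:ℂ)‖ = x := by simp [abs_of_pos hx]
  have hee : exp R * (x * exp (-R)) = x := by
    rw [mul_left_comm, ← exp_add]; simp
  have hc := log_cmp (a := exp R) (r := x * exp (-R)) (m := ‖x + Complex.exp (R + y * Complex.I)‖)
    (exp_pos _) (by positivity) hR' (by
      have := norm_sub_norm_le (Complex.exp (R + y * Complex.I)) (-x)
      rw [norm_neg, hn, hxn, sub_neg_eq_add, add_comm _ (x:ℂ)] at this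
      linarith) (by
      have := norm_add_le (x:ℂ) (Complex.exp (R + y * Complex.I))
      rw [hn, hxn] at this
      linarith)
  rw [log_exp] at hc
  unfold ff
  rw [Complex.mul_re, Complex.log_re, Complex.log_im]
  have hp := Complex.abs_arg_le_pi (x + Complex.exp (R + y * Complex.I))
  have m1 := (Complex.abs_re_le_norm (MM α (R + y * Complex.I) - 1)).trans hM
  have m2 := (Complex.abs_im_le_norm (MM α (R + y * Complex.I) - 1)).trans hM
  simp only [Complex.sub_re, Complex.sub_im, Complex.one_re, Complex.one_im, sub_zero] at m1 m2
  generalize exp (-α * R) / (1 - exp (-α * R)) = δ at *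
  generalize -log (1 - x * exp (-R)) = η at *
  generalize log ‖x + Complex.exp (R + y * Complex.I)‖ = A at *
  generalize (x + Complex.exp (R + y * Complex.I)).arg = B at *
  generalize (MM α (R + y * Complex.I)).re = p at *
  generalize (MM α (R + y * Complex.I)).im = q at *
  have e : A * p - B * q - R = (A - R) * p + R * (p - 1) - B * q := by ring
  have hp1 : |p| ≤ 1 + δ := by
    have := abs_add_le (p - 1) 1
    simp at this
    linarith
  have t1 : |(A - R) * p| ≤ η * (1 + δ) := by
    rw [abs_mul]; exact mul_le_mul hc hp1 (abs_nonneg _) ((abs_nonneg _).trans hc)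
  have t2 : |R * (p - 1)| ≤ R * δ := by
    rw [abs_mul, abs_of_pos hR]; gcongr
  have t3 : |B * q| ≤ π * δ := by
    rw [abs_mul]; exact mul_le_mul hp m2 (abs_nonneg _) pi_pos.le
  rw [e]
  have a1 := abs_sub ((A - R) * p + R * (p - 1)) (B * q)
  have a2 := abs_add_le ((A - R) * p) (R * (p - 1))
  linarith

lemma left_bound {α x : ℝ} (h0 : 0 < α) (hx : 0 < x) {R : ℝ} (hR : 0 < R)
    (hR' : x⁻¹ * exp (-R) < 1) (y : ℝ) :
    |(ff α x (-R + y * Complex.I)).re| ≤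
      (|log x| + -log (1 - x⁻¹ * exp (-R)) + π) * (exp (-α * R) / (1 - exp (-α * R))) := by
  have hM := MM_norm h0 hR y
  have hn : ‖Complex.exp (-R + y * Complex.I)‖ = exp (-R) := by rw [Complex.norm_exp]; simp
  have hxn : ‖(x:ℂ)‖ = x := by simp [abs_of_pos hx]
  have hee : x * (x⁻¹ * exp (-R)) = exp (-R) := by field_simp
  have hc := log_cmp (a := x) (r := x⁻¹ * exp (-R)) (m := ‖x + Complex.exp (-R + y * Complex.I)‖)
    hx (by positivity) hR' (by
      have := norm_sub_norm_le (x:ℂ) (-Complex.exp (-R + y * Complex.I))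
      rw [norm_neg, hn, hxn, sub_neg_eq_add] at this
      linarith) (by
      have := norm_add_le (x:ℂ) (Complex.exp (-R + y * Complex.I))
      rw [hn, hxn] at this
      linarith)
  refine (Complex.abs_re_le_norm _).trans ?_
  unfold ff
  rw [norm_mul]
  have h3 := norm_clog_le (x + Complex.exp (-R + y * Complex.I))
  have h4 := abs_add_le (log ‖x + Complex.exp (-R + y * Complex.I)‖ - log x) (log x)
  rw [sub_add_cancel] at h4
  have h5 := (abs_nonneg _).trans hc
  have := pi_pos
  exact mul_le_mul (by linarith) hM (norm_nonneg _) (by positivity)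

lemma tend_exp {a : ℝ} (h0 : 0 < a) : Tendsto (fun R : ℝ => exp (-a * R)) atTop (𝓝 0) := by
  refine tendsto_exp_atBot.comp ?_
  exact tendsto_id.const_mul_atTop_of_neg (by linarith)

lemma tend_delta {α : ℝ} (h0 : 0 < α) :
    Tendsto (fun R : ℝ => exp (-α * R) / (1 - exp (-α * R))) atTop (𝓝 0) := by
  have := (tend_exp h0).div ((tendsto_const_nhds (x := (1:ℝ))).sub (tend_exp h0)) (by simp)
  simpa [Pi.div_def] using this

lemma tend_Rdelta {α : ℝ} (h0 : 0 < α) :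
    Tendsto (fun R : ℝ => R * (exp (-α * R) / (1 - exp (-α * R)))) atTop (𝓝 0) := by
  have h := tendsto_rpow_mul_exp_neg_mul_atTop_nhds_zero 1 α h0
  simp only [rpow_one] at h
  have := h.div ((tendsto_const_nhds (x := (1:ℝ))).sub (tend_exp h0)) (by simp)
  simpa [Pi.div_def, mul_div_assoc] using this

lemma tend_eta (c : ℝ) : Tendsto (fun R : ℝ => -log (1 - c * exp (-R))) atTop (𝓝 0) := by
  have h := (tend_exp one_pos).const_mul c
  have h2 := ((tendsto_const_nhds (x := (1:ℝ))).sub h)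
  simp only [mul_zero, sub_zero, neg_mul, one_mul] at h2
  have := (h2.log one_ne_zero).neg
  simpa using this

lemma tend_small (c : ℝ) : ∀ᶠ R : ℝ in atTop, c * exp (-R) < 1 := by
  have h := (tend_exp one_pos).const_mul c
  simp only [mul_zero, neg_mul, one_mul] at h
  exact h.eventually_lt_const one_pos

lemma tend_PP {α : ℝ} (h0 : 0 < α) (h1 : α < 1) : Tendsto (fun R => PP α R - R) atTop (𝓝 0) := by
  have h := tend_exp h0
  have h2 := ((h.mul_const (2 * cos (π * α))).add (h.pow 2)).const_add 1
  simp at h2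
  have h3 := (h2.log one_ne_zero).const_mul (1 / (2 * α))
  simp only [log_one, mul_zero] at h3
  refine h3.congr fun R => ?_
  unfold PP
  have e : DD α R = exp (2 * α * R) *
      (1 + (exp (-(α * R)) * (2 * cos (π * α)) + exp (-(α * R)) ^ 2)) := by
    unfold DD
    have : exp (2 * α * R) = exp (R * α) ^ 2 := by rw [← exp_nat_mul]; congr 1; push_cast; ring
    rw [this, exp_neg, mul_comm α R]
    field_simp
    ring
  have hD := DD_pos h0 h1 R
  rw [e] at hD ⊢
  rw [log_mul (exp_pos _).ne' (pos_of_mul_pos_right hD (exp_pos _).le |>.ne'), log_exp]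
  field_simp
  ring

lemma tend_main {α x : ℝ} (h0 : 0 < α) (h1 : α < 1) (hx : 0 < x) :
    Tendsto (fun R : ℝ => ∫ v in (-R)..R, log |x - exp v| * gg α v) atTop (𝓝 (π * PP α (log x))) := by
  have hpi := pi_pos
  have l1 : Tendsto (fun R : ℝ => (∫ y in (0:ℝ)..π, (ff α x (R + y * Complex.I)).re) - π * R) atTop (𝓝 0) := by
    have hb := ((tend_eta x).mul ((tend_delta h0).const_add 1)).add
      ((tend_Rdelta h0).add ((tend_delta h0).const_mul π)) |>.mul_const |π - 0|
    simp only [zero_mul, mul_zero, add_zero] at hb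
    refine squeeze_zero_norm' ?_ hb
    filter_upwards [tend_small x, eventually_gt_atTop 0] with R h2 h3
    have anR : ∀ t, AnalyticAt ℝ (fun v : ℝ => (v : ℂ)) t := fun t => Complex.ofRealCLM.analyticAt t
    have i3 := sideInt (x := x) h0 h1 (fun y : ℝ => (R + y * Complex.I : ℂ))
      (fun t => analyticAt_const.add ((anR t).mul analyticAt_const)) 0 π
      (by intro t ht; rw [uIcc_of_le hpi.le] at ht; simpa using ht)
    have i3' : IntervalIntegrable (fun y : ℝ => (ff α x (R + y * Complex.I)).re) volume 0 π :=
      ⟨i3.1.re, i3.2.re⟩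
    have : (∫ y in (0:ℝ)..π, (ff α x (R + y * Complex.I)).re) - π * R =
        ∫ y in (0:ℝ)..π, ((ff α x (R + y * Complex.I)).re - R) := by
      rw [intervalIntegral.integral_sub i3' intervalIntegrable_const]
      simp
    rw [this]
    refine intervalIntegral.norm_integral_le_of_norm_le_const fun y _ => ?_
    refine (right_bound h0 hx h3 h2 y).trans (le_of_eq ?_)
    ring
  have l2 : Tendsto (fun R : ℝ => ∫ y in (0:ℝ)..π, (ff α x (-R + y * Complex.I)).re) atTop (𝓝 0) := by
    have hb := (((tend_eta x⁻¹).const_add (|log x|)).add_const π).mul (tend_delta h0) |>.mul_const |π - 0|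
    simp only [zero_mul, mul_zero] at hb
    refine squeeze_zero_norm' ?_ hb
    filter_upwards [tend_small x⁻¹, eventually_gt_atTop 0] with R h2 h3
    exact intervalIntegral.norm_integral_le_of_norm_le_const fun y _ => left_bound h0 hx h3 h2 y
  have := ((l1.const_add (π * PP α (log x))).sub ((tend_PP h0 h1).const_mul π)).sub l2
  simp only [mul_zero, add_zero, sub_zero] at this
  refine this.congr' ?_
  filter_upwards [eventually_gt_atTop |log x|] with R hR
  exact (finiteR h0 h1 hx hR).symm

lemma gg_bounds {α : ℝ} (h0 : 0 < α) (h1 : α < 1) (v : ℝ) :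
    ‖gg α v‖ ≤ (sin (π * α))⁻¹ * exp (α * v) ∧ ‖gg α v‖ ≤ (sin (π * α))⁻¹ * exp (-α * v) := by
  have hs := sin_pos' h0 h1
  have hD := DD_pos h0 h1 v
  have hsc := sin_sq_add_cos_sq (π * α)
  have ht := exp_pos (v * α)
  have hg : 0 ≤ gg α v := by unfold gg; positivity
  rw [norm_eq_abs, abs_of_nonneg hg]
  have e : exp (-α * v) = (exp (v * α))⁻¹ := by rw [← exp_neg]; congr 1; ring
  rw [e, mul_comm α v]
  unfold gg
  unfold DD at *
  generalize cos (π * α) = c at *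
  generalize sin (π * α) = s at *
  generalize exp (v * α) = t at *
  constructor
  · rw [div_le_iff₀ hD]
    have : s ^ 2 ≤ t ^ 2 + 2 * t * c + 1 := by nlinarith [sq_nonneg (t + c)]
    calc s * t = s⁻¹ * t * s ^ 2 := by field_simp
      _ ≤ _ := by gcongr
  · rw [div_le_iff₀ hD]
    have : s ^ 2 * t ^ 2 ≤ t ^ 2 + 2 * t * c + 1 := by nlinarith [sq_nonneg (t * c + 1)]
    calc s * t = s⁻¹ * t⁻¹ * (s ^ 2 * t ^ 2) := by field_simp
      _ ≤ _ := by gcongr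

lemma int_main {α x : ℝ} (h0 : 0 < α) (h1 : α < 1) (hx : 0 < x) :
    Integrable (fun v => log |x - exp v| * gg α v) := by
  have hloc : LocallyIntegrable (fun v => log |x - exp v| * gg α v) := by
    rw [locallyIntegrable_iff]
    intro k hk
    obtain ⟨a, b, hab⟩ : ∃ a b : ℝ, k ⊆ Icc a b := by
      obtain ⟨a, ha⟩ := hk.bddBelow
      obtain ⟨b, hb⟩ := hk.bddAbove
      exact ⟨a, b, fun t ht => ⟨ha ht, hb ht⟩⟩
    rcases le_or_gt a b with h | h
    · have := (logg_int (x := x) a b).mul_continuousOn (cont_gg h0 h1).continuousOn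
      rw [intervalIntegrable_iff_integrableOn_Icc_of_le h] at this
      exact this.mono_set hab
    · rw [Icc_eq_empty (not_le.2 h)] at hab
      rw [subset_empty_iff.1 hab]
      exact integrableOn_empty
  have g1 : ∀ l, (gg α) =O[l] (fun v => exp (α * v)) := fun l =>
    Asymptotics.IsBigO.of_bound _ (Eventually.of_forall fun v => by
      rw [norm_of_nonneg (exp_pos _).le]; exact (gg_bounds h0 h1 v).1)
  have g2 : ∀ l, (gg α) =O[l] (fun v => exp (-α * v)) := fun l =>
    Asymptotics.IsBigO.of_bound _ (Eventually.of_forall fun v => by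
      rw [norm_of_nonneg (exp_pos _).le]; exact (gg_bounds h0 h1 v).2)
  have b1 : (fun v => log |x - exp v|) =O[atBot] (fun _ => (1:ℝ)) := by
    have : Tendsto (fun v => log |x - exp v|) atBot (𝓝 (log |x - 0|)) := by
      refine Tendsto.log ?_ (by simp [hx.ne'])
      exact (tendsto_const_nhds.sub tendsto_exp_atBot).abs
    exact this.isBigO_one ℝ
  have b2 : (fun v => log |x - exp v|) =O[atTop] (fun v => exp (α / 2 * v)) := by
    have o1 : (fun v : ℝ => v) =O[atTop] (fun v => exp (α / 2 * v)) := by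
      simpa using (isLittleO_pow_exp_pos_mul_atTop 1 (half_pos h0)).isBigO
    have o2 : (fun v : ℝ => -log (1 - x * exp (-v))) =O[atTop] (fun v => exp (α / 2 * v)) := by
      refine ((tend_eta x).isBigO_one ℝ).trans ?_
      refine Asymptotics.IsBigO.of_bound 1 ?_
      filter_upwards [eventually_ge_atTop 0] with v hv
      rw [norm_of_nonneg (exp_pos _).le, norm_one, one_mul]
      exact one_le_exp (by positivity)
    refine (o1.sub o2).congr' ?_ EventuallyEq.rfl
    filter_upwards [tend_small x] with v hv
    have e : |x - exp v| = exp v * (1 - x * exp (-v)) := by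
      rw [abs_sub_comm, ← abs_of_pos (mul_pos (exp_pos v) (sub_pos.2 hv))]
      congr 1
      rw [exp_neg]; field_simp
    rw [e, log_mul (exp_pos _).ne' (sub_pos.2 hv).ne', log_exp]
    ring
  refine hloc.integrable_of_isBigO_atBot_atTop (g := fun v => exp (α * v))
    (g' := fun v => exp (-(α / 2) * v)) ?_ ?_ ?_ ?_
  · simpa using b1.mul (g1 atBot)
  · exact ⟨Iic 0, Iic_mem_atBot 0, integrableOn_exp_mul_Iic h0 0⟩
  · refine (b2.mul (g2 atTop)).congr_right fun v => ?_
    rw [← exp_add]; congr 1; ring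
  · exact ⟨Ioi 0, Ioi_mem_atTop 0, integrableOn_exp_mul_Ioi (by linarith) 0⟩

theorem stmt_4 (α x : ℝ) (hα0 : 0 < α) (hα1 : α < 1) (hx : 0 < x) :
    ∫ u in Ioi (0:ℝ),
      Real.log |x - u| * ((Real.sin (π * α) / π) * u ^ (α - 1) /
        (u ^ (2 * α) + 2 * u ^ α * Real.cos (π * α) + 1))
    = (1 / (2 * α)) * Real.log (x ^ (2 * α) + 2 * x ^ α * Real.cos (α * π) + 1) := by
  have hpi := pi_pos
  have hlim := intervalIntegral_tendsto_integral (int_main hα0 hα1 hx) tendsto_neg_atTop_atBot tendsto_id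
  have hval := tendsto_nhds_unique hlim (tend_main hα0 hα1 hx)
  have himg : Real.exp '' univ = Ioi 0 := by rw [image_univ, Real.range_exp]
  rw [← himg, integral_image_eq_integral_abs_deriv_smul MeasurableSet.univ
    (fun v _ => (Real.hasDerivAt_exp v).hasDerivWithinAt) Real.exp_injective.injOn, setIntegral_univ]
  have e2 : ∀ v : ℝ, Real.exp v ^ (2 * α) = Real.exp (v * α) ^ 2 := by
    intro v
    rw [← Real.exp_mul, ← Real.exp_nat_mul]; congr 1; push_cast; ring
  have hpt : ∀ v : ℝ, |Real.exp v| • (Real.log |x - Real.exp v| * ((Real.sin (π * α) / π) * Real.exp v ^ (α - 1) /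
        (Real.exp v ^ (2 * α) + 2 * Real.exp v ^ α * Real.cos (π * α) + 1))) =
      (Real.log |x - Real.exp v| * gg α v) * π⁻¹ := by
    intro v
    have e3 : Real.exp v * Real.exp v ^ (α - 1) = Real.exp (v * α) := by
      rw [← Real.exp_mul, ← Real.exp_add]; congr 1; ring
    rw [abs_of_pos (Real.exp_pos v), smul_eq_mul, e2, ← Real.exp_mul v α]
    unfold gg DD
    rw [← e3]
    ring
  simp_rw [hpt]
  rw [integral_mul_const, hval]
  unfold PP DD
  rw [← e2, Real.exp_log hx, Real.exp_mul, Real.exp_log hx, mul_comm α π]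
  field_simp
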